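/- arXiv:2406.05777 — 2 statements merged into one kernel-verified Lean document; each statement's English description precedes it below -/
import Mathlib

section
/- Let H be a complex Hilbert space, U a unitary operator on H, and g ∈ H. Then U is K(U,g)-reduced if and only if the inverse problem U f = g is Krylov-solvable, i.e., if and only if the unique solution f = U* g belongs to the closure of K(U,g). -/
/-- The Krylov subspace `K(A,g) = span {g, Ag, A²g, ...}`. -/
def krylov {H : Type*} [NormedAddCommGroup H] [InnerProductSpace ℂ H]
    (A : H →L[ℂ] H) (g : H) : Submodule ℂ H :=
  Submodule.span ℂ (Set.range fun n : ℕ => (A ^ n) g)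

theorem mem_krylov_orthogonal_iff {H : Type*} [NormedAddCommGroup H] [InnerProductSpace ℂ H]
    (A : H →L[ℂ] H) (g x : H) :
    x ∈ (krylov A g)ᗮ ↔ ∀ n : ℕ, inner ℂ ((A ^ n) g) x = 0 := by
  rw [Submodule.mem_orthogonal]
  constructor
  · intro h n
    exact h _ (Submodule.subset_span ⟨n, rfl⟩)
  · intro h u hu
    induction hu using Submodule.span_induction with
    | mem y hy =>
      obtain ⟨n, rfl⟩ := hy
      exact h n
    | zero => exact inner_zero_left x
    | add y z _ _ hy hz => rw [inner_add_left, hy, hz, add_zero]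
    | smul c y _ hy => rw [inner_smul_left, hy, mul_zero]

/-- For a unitary operator `U` on a complex Hilbert space, `U` is `K(U,g)`-reduced if and only
if the inverse problem `U f = g` is Krylov-solvable, i.e. iff the unique solution `f = U* g`
belongs to the closure of `K(U,g)`. -/
theorem unitary_krylovReduced_iff_krylovSolvable
    {H : Type*} [NormedAddCommGroup H] [InnerProductSpace ℂ H] [CompleteSpace H]
    (U : H →L[ℂ] H)
    (hU₁ : ContinuousLinearMap.adjoint U ∘L U = 1)
    (hU₂ : U ∘L ContinuousLinearMap.adjoint U = 1)
    (g : H) :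
    (∀ x ∈ (krylov U g)ᗮ, U x ∈ (krylov U g)ᗮ) ↔
      (ContinuousLinearMap.adjoint U) g ∈ (krylov U g).topologicalClosure := by
  rw [← Submodule.orthogonal_orthogonal_eq_closure, Submodule.mem_orthogonal]
  constructor
  · intro h x hx
    rw [ContinuousLinearMap.adjoint_inner_right]
    simpa using inner_eq_zero_symm.mp ((mem_krylov_orthogonal_iff U g (U x)).mp (h x hx) 0)
  · intro h x hx
    rw [mem_krylov_orthogonal_iff]
    rintro (_ | n)
    · rw [pow_zero, one_apply_eq_self, ← ContinuousLinearMap.adjoint_inner_left]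
      exact inner_eq_zero_symm.mp (h x hx)
    · have hUx : ContinuousLinearMap.adjoint U (U ((U ^ n) g)) = (U ^ n) g :=
        DFunLike.congr_fun hU₁ ((U ^ n) g)
      rw [pow_succ', mul_apply_eq_comp, ← ContinuousLinearMap.adjoint_inner_left, hUx]
      exact (mem_krylov_orthogonal_iff U g x).mp hx n
end

section
/- Let H be a complex Hilbert space, A a bounded linear operator on H, and g ∈ ran A. If the Krylov intersection I(A,g) is trivial, i.e., I(A,g) = {0}, then there exists a Krylov solution f ∈ closure of K(A,g) to the inverse linear problem A f = g. -/
/-- The Krylov intersection `I(A,g) := closure(K(A,g)) ∩ A(K(A,g)ᗮ)`. -/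
def krylovIntersection {H : Type*} [NormedAddCommGroup H] [InnerProductSpace ℂ H]
    (A : H →L[ℂ] H) (g : H) : Set H :=
  ((krylov A g).topologicalClosure : Set H) ∩ (A '' ((krylov A g)ᗮ : Set H))

theorem map_mem_topologicalClosure_krylov
    {H : Type*} [NormedAddCommGroup H] [InnerProductSpace ℂ H]
    (A : H →L[ℂ] H) (g : H) {x : H} (hx : x ∈ (krylov A g).topologicalClosure) :
    A x ∈ (krylov A g).topologicalClosure := by
  have h_maps : Set.MapsTo A (krylov A g) (krylov A g) := by
    suffices h : krylov A g ≤ (krylov A g).comap (A : H →ₗ[ℂ] H) from h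
    refine Submodule.span_le.2 ?_
    rintro _ ⟨n, rfl⟩
    exact Submodule.subset_span ⟨n + 1, by simp [pow_succ']⟩
  exact h_maps.closure A.continuous hx

theorem self_mem_topologicalClosure_krylov
    {H : Type*} [NormedAddCommGroup H] [InnerProductSpace ℂ H]
    (A : H →L[ℂ] H) (g : H) : g ∈ (krylov A g).topologicalClosure :=
  Submodule.le_topologicalClosure _ (Submodule.subset_span ⟨0, by simp⟩)

/-- If the Krylov intersection `I(A,g)` is trivial and `g ∈ ran A`, then the inverse problem
`A f = g` admits a Krylov solution `f ∈ closure(K(A,g))`. -/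
theorem krylovIntersection_trivial_krylovSolvable
    {H : Type*} [NormedAddCommGroup H] [InnerProductSpace ℂ H] [CompleteSpace H]
    (A : H →L[ℂ] H) (g : H) (hg : g ∈ Set.range A)
    (htriv : krylovIntersection A g = {0}) :
    ∃ f ∈ (krylov A g).topologicalClosure, A f = g := by
  obtain ⟨f, rfl⟩ := hg
  have : CompleteSpace (krylov A (A f)).topologicalClosure :=
    (Submodule.isClosed_topologicalClosure _).completeSpace_coe
  obtain ⟨u, hu, v, hv, rfl⟩ :=
    (krylov A (A f)).topologicalClosure.exists_add_mem_mem_orthogonal f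
  refine ⟨u, hu, ?_⟩
  have hAv : A v ∈ krylovIntersection A (A (u + v)) := by
    refine ⟨?_, v, Submodule.orthogonal_le (Submodule.le_topologicalClosure _) hv, rfl⟩
    have h := Submodule.sub_mem _ (self_mem_topologicalClosure_krylov A (A (u + v)))
      (map_mem_topologicalClosure_krylov A _ hu)
    simpa only [map_add, SetLike.mem_coe, add_sub_cancel_left] using h
  rw [htriv, Set.mem_singleton_iff] at hAv
  rw [map_add, hAv, add_zero]
end
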